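/- arXiv:1303.7081 — 3 statements merged into one kernel-verified Lean document; each statement's English description precedes it below -/
import Mathlib

section
/- Let x ∈ R_ap. Then the closure of [x]_ap satisfies cl([x]_ap) ⊂ [x]_ap ∪ ∂Δ. Moreover [x]_ap is invariant under the flow: φ_t([x]_ap) = [x]_ap for every t ∈ ℝ. -/
open Metric Set Filter Topology
open scoped Classical ENNReal

noncomputable section

abbrev Euc (d : ℕ) := EuclideanSpace ℝ (Fin d)

/-- The standard simplex `Δ`. -/
def simplexSet (d : ℕ) : Set (Euc d) := {x | (∀ i, 0 ≤ x i) ∧ ∑ i, x i = 1}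

/-- The relative interior `Δ̊`. -/
def simplexInt (d : ℕ) : Set (Euc d) := {x | (∀ i, 0 < x i) ∧ ∑ i, x i = 1}

/-- The relative boundary `∂Δ`. -/
def simplexBd (d : ℕ) : Set (Euc d) := simplexSet d \ simplexInt d

/-- `Δ_N = Δ ∩ (1/N)ℤ^d`. -/
def deltaN (d N : ℕ) : Set (Euc d) := simplexSet d ∩ {x | ∀ i, ∃ z : ℤ, x i = (z : ℝ) / N}

/-- `Δ*_N = Δ̊ ∩ (1/N)ℤ^d`. -/
def deltaNstar (d N : ℕ) : Set (Euc d) := simplexInt d ∩ {x | ∀ i, ∃ z : ℤ, x i = (z : ℝ) / N}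

/-- `F` is locally Lipschitz on `Δ` and its coordinates sum to zero. -/
def IsMeanField (d : ℕ) (F : Euc d → Euc d) : Prop :=
  (∀ x ∈ simplexSet d, ∃ (K : NNReal) (ε : ℝ), 0 < ε ∧
      LipschitzOnWith K F (Metric.ball x ε ∩ simplexSet d)) ∧
  ∀ x ∈ simplexSet d, ∑ i, F x i = 0

/-- `φ` is the flow induced by the ODE `ẋ = F(x)`, leaving `Δ` and `∂Δ` invariant. -/
structure IsFlowOf (d : ℕ) (F : Euc d → Euc d) (φ : ℝ → Euc d → Euc d) : Prop where
  cont : Continuous fun p : ℝ × Euc d => φ p.1 p.2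
  map_zero : ∀ x, φ 0 x = x
  map_add : ∀ s t x, φ (s + t) x = φ s (φ t x)
  deriv : ∀ x ∈ simplexSet d, ∀ t : ℝ, HasDerivAt (fun s => φ s x) (F (φ t x)) t
  inv : ∀ t : ℝ, ∀ x ∈ simplexSet d, φ t x ∈ simplexSet d
  bdInv : ∀ t : ℝ, ∀ x ∈ simplexBd d, φ t x ∈ simplexBd d

/-- The data `(k, xs, ts)` is a `(δ,T)` absorption-preserving pseudo-orbit:
points `xs 0, …, xs (k+1)` of `Δ` and times `ts 1, …, ts k ≥ T`. -/
def IsAPOrbit (d : ℕ) (φ : ℝ → Euc d → Euc d) (δ T : ℝ) (k : ℕ)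
    (xs : ℕ → Euc d) (ts : ℕ → ℝ) : Prop :=
  1 ≤ k ∧ (∀ j ≤ k + 1, xs j ∈ simplexSet d) ∧ dist (xs 0) (xs 1) < δ ∧
  (∀ j, 1 ≤ j → j ≤ k → T ≤ ts j ∧ dist (φ (ts j) (xs j)) (xs (j + 1)) < δ) ∧
  (∀ j ≤ k, xs j ∈ simplexBd d → xs (j + 1) ∈ simplexBd d)

/-- `x ⇝_ap y`. -/
def leadsAp (d : ℕ) (φ : ℝ → Euc d → Euc d) (x y : Euc d) : Prop :=
  ∀ δ > (0 : ℝ), ∀ T > (0 : ℝ), ∃ k xs ts,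
    IsAPOrbit d φ δ T k xs ts ∧ xs 0 = x ∧ xs (k + 1) = y

/-- The set `R_ap` of ap-chain-recurrent points. -/
def Rap (d : ℕ) (φ : ℝ → Euc d → Euc d) : Set (Euc d) := {x | leadsAp d φ x x}

/-- The ap-basic class `[x]_ap`. -/
def apClass (d : ℕ) (φ : ℝ → Euc d → Euc d) (x : Euc d) : Set (Euc d) :=
  {y | leadsAp d φ x y ∧ leadsAp d φ y x}

/-- The class of `x` is maximal for the order `≺`, i.e. is an ap-quasi-attractor. -/
def IsAPQuasiAttractorAt (d : ℕ) (φ : ℝ → Euc d → Euc d) (x : Euc d) : Prop :=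
  x ∈ Rap d φ ∧ ∀ y ∈ Rap d φ, leadsAp d φ x y → leadsAp d φ y x

/-- The omega-limit set of `x` under the flow `φ`. -/
def omegaSet (d : ℕ) (φ : ℝ → Euc d → Euc d) (x : Euc d) : Set (Euc d) :=
  {y | ∃ u : ℕ → ℝ, Tendsto u atTop atTop ∧ Tendsto (fun n => φ (u n) x) atTop (nhds y)}

/-- `A` is an attractor for the flow `φ`: compact, invariant, attracting a
neighborhood uniformly. -/
def IsAttractor (d : ℕ) (φ : ℝ → Euc d → Euc d) (A : Set (Euc d)) : Prop :=
  IsCompact A ∧ (∀ t : ℝ, φ t '' A = A) ∧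
  ∃ U : Set (Euc d), IsOpen U ∧ A ⊆ U ∧
    ∀ ε > (0 : ℝ), ∃ T : ℝ, ∀ t ≥ T, ∀ x ∈ U, infDist (φ t x) A < ε


lemma bd_iff {d : ℕ} {F : Euc d → Euc d} {φ : ℝ → Euc d → Euc d} (hφ : IsFlowOf d F φ)
    (t : ℝ) (y : Euc d) : φ t y ∈ simplexBd d ↔ y ∈ simplexBd d := by
  refine ⟨fun h => ?_, hφ.bdInv t y⟩
  have h2 := hφ.bdInv (-t) _ h
  rwa [← hφ.map_add, neg_add_cancel, hφ.map_zero] at h2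

lemma flow_near {d : ℕ} {F : Euc d → Euc d} {φ : ℝ → Euc d → Euc d} (hφ : IsFlowOf d F φ)
    (t : ℝ) (y : Euc d) (δ : ℝ) (hδ : 0 < δ) :
    ∃ η > 0, η ≤ δ ∧ ∀ w, dist w y < η → dist (φ t w) (φ t y) < δ := by
  have hc : Continuous (φ t) := hφ.cont.comp (Continuous.prodMk_right t)
  obtain ⟨η, h0, h⟩ := Metric.continuous_iff.1 hc y δ hδ
  exact ⟨min η δ, lt_min h0 hδ, min_le_right _ _,
    fun w hw => h w (lt_of_lt_of_le hw (min_le_left _ _))⟩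

lemma leads_flow_end {d : ℕ} {F : Euc d → Euc d} {φ : ℝ → Euc d → Euc d} (hφ : IsFlowOf d F φ)
    (t : ℝ) {a y : Euc d} (h : leadsAp d φ a y) : leadsAp d φ a (φ t y) := by
  intro δ hδ T hT
  obtain ⟨η, hη, hηδ, hw⟩ := flow_near hφ t y δ hδ
  obtain ⟨k, xs, ts, ⟨hk, hm, h01, hs, hb⟩, h0, he⟩ := h η hη (T + |t|) (by positivity)
  refine ⟨k, fun j => if j = k + 1 then φ t y else xs j,
    fun j => if j = k then ts k + t else ts j, ⟨hk, ?_, ?_, ?_, ?_⟩, ?_, ?_⟩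
  · intro j hj
    dsimp only
    split_ifs with hjk
    · exact hφ.inv t y (he ▸ hm (k+1) le_rfl)
    · exact hm j hj
  · have : (1 : ℕ) ≠ k + 1 := by omega
    simp only [this, if_false]
    have : (0 : ℕ) ≠ k + 1 := by omega
    simp only [this, if_false]
    linarith
  · intro j h1 h2
    have hne : j ≠ k + 1 := by omega
    have := hs j h1 h2
    have ha := neg_abs_le t
    have ha' := abs_nonneg t
    by_cases hjk : j = k
    · subst hjk
      simp only [if_true, hne, if_false]
      refine ⟨by linarith, ?_⟩
      rw [add_comm, hφ.map_add]
      exact hw _ (he ▸ this.2)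
    · have h3 : j + 1 ≠ k + 1 := by omega
      simp only [hjk, hne, h3, if_false]
      exact ⟨by linarith, by linarith⟩
  · intro j hj
    have hne : j ≠ k + 1 := by omega
    by_cases hjk : j = k
    · subst hjk
      simp only [if_true, hne, if_false, bd_iff hφ]
      exact he ▸ hb j le_rfl
    · have h3 : j + 1 ≠ k + 1 := by omega
      simp only [hne, h3, if_false]
      exact hb j hj
  · have : (0 : ℕ) ≠ k + 1 := by omega
    simp only [this, if_false, h0]
  · simp

lemma leads_flow_start {d : ℕ} {F : Euc d → Euc d} {φ : ℝ → Euc d → Euc d}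
    (hφ : IsFlowOf d F φ)
    (t : ℝ) {a y : Euc d} (h : leadsAp d φ y a) : leadsAp d φ (φ t y) a := by
  intro δ hδ T hT
  obtain ⟨η, hη, hηδ, hw⟩ := flow_near hφ t y δ hδ
  obtain ⟨k, xs, ts, ⟨hk, hm, h01, hs, hb⟩, h0, he⟩ := h η hη (T + |t|) (by positivity)
  have hx : ∀ j, (if j ≤ 1 then φ t (xs j) else xs j) ∈ simplexBd d ↔ xs j ∈ simplexBd d := by
    intro j
    split_ifs
    · exact bd_iff hφ _ _
    · rfl
  refine ⟨k, fun j => if j ≤ 1 then φ t (xs j) else xs j,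
    fun j => if j = 1 then ts 1 - t else ts j, ⟨hk, ?_, ?_, ?_, ?_⟩, ?_, ?_⟩
  · intro j hj
    dsimp only
    split_ifs with hjk
    · exact hφ.inv t _ (hm j hj)
    · exact hm j hj
  · simp only [zero_le, le_refl, if_true, h0]
    rw [dist_comm]
    refine hw _ ?_
    rw [dist_comm]
    exact h0 ▸ h01
  · intro j h1 h2
    have hne : ¬ (j + 1 ≤ 1) := by omega
    have := hs j h1 h2
    have ha := le_abs_self t
    have ha' := abs_nonneg t
    by_cases hjk : j = 1
    · subst hjk
      simp only [if_true, hne, if_false, le_refl]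
      refine ⟨by linarith, ?_⟩
      rw [← hφ.map_add, sub_add_cancel]
      linarith
    · have h3 : ¬ (j ≤ 1) := by omega
      simp only [hjk, hne, h3, if_false]
      exact ⟨by linarith, by linarith⟩
  · intro j hj
    simp only [hx]
    exact hb j hj
  · simp [h0]
  · have : ¬ (k + 1 ≤ 1) := by omega
    simp only [this, if_false, he]

lemma leads_close_end {d : ℕ} {φ : ℝ → Euc d → Euc d} {a z : Euc d} (hz : z ∈ simplexSet d)
    (h : ∀ ε > 0, ∃ y, y ∉ simplexBd d ∧ dist z y < ε ∧ leadsAp d φ a y) :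
    leadsAp d φ a z := by
  intro δ hδ T hT
  obtain ⟨y, hy, hzy, hl⟩ := h (δ / 2) (by positivity)
  obtain ⟨k, xs, ts, ⟨hk, hm, h01, hs, hb⟩, h0, he⟩ := hl (δ / 2) (by positivity) T hT
  refine ⟨k, fun j => if j = k + 1 then z else xs j, ts, ⟨hk, ?_, ?_, ?_, ?_⟩, ?_, ?_⟩
  · intro j hj
    dsimp only
    split_ifs with hjk
    · exact hz
    · exact hm j hj
  · have : (1 : ℕ) ≠ k + 1 := by omega
    simp only [this, if_false]
    have : (0 : ℕ) ≠ k + 1 := by omega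
    simp only [this, if_false]
    linarith
  · intro j h1 h2
    have hne : j ≠ k + 1 := by omega
    have := hs j h1 h2
    refine ⟨this.1, ?_⟩
    by_cases hjk : j = k
    · subst hjk
      simp only [if_true, hne, if_false]
      rw [he] at this
      have := dist_triangle_right (φ (ts j) (xs j)) z y
      linarith
    · have h3 : j + 1 ≠ k + 1 := by omega
      simp only [hne, h3, if_false]
      linarith
  · intro j hj
    have hne : j ≠ k + 1 := by omega
    by_cases hjk : j = k
    · subst hjk
      simp only [if_true, hne, if_false]
      intro hj2
      exact absurd (he ▸ hb j le_rfl hj2) hy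
    · have h3 : j + 1 ≠ k + 1 := by omega
      simp only [hne, h3, if_false]
      exact hb j hj
  · have : (0 : ℕ) ≠ k + 1 := by omega
    simp only [this, if_false, h0]
  · simp

lemma leads_close_start {d : ℕ} {φ : ℝ → Euc d → Euc d} {a z : Euc d} (hz : z ∈ simplexSet d)
    (hzb : z ∉ simplexBd d)
    (h : ∀ ε > 0, ∃ y, dist z y < ε ∧ leadsAp d φ y a) :
    leadsAp d φ z a := by
  intro δ hδ T hT
  obtain ⟨y, hzy, hl⟩ := h (δ / 2) (by positivity)
  obtain ⟨k, xs, ts, ⟨hk, hm, h01, hs, hb⟩, h0, he⟩ := hl (δ / 2) (by positivity) T hT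
  refine ⟨k, fun j => if j = 0 then z else xs j, ts, ⟨hk, ?_, ?_, ?_, ?_⟩, ?_, ?_⟩
  · intro j hj
    dsimp only
    split_ifs with hjk
    · exact hz
    · exact hm j hj
  · simp only [if_true, one_ne_zero, if_false]
    rw [h0] at h01
    have := dist_triangle z y (xs 1)
    linarith
  · intro j h1 h2
    have hne : j ≠ 0 := by omega
    have := hs j h1 h2
    simp only [hne, if_false, Nat.add_one_ne_zero]
    exact ⟨this.1, by linarith⟩
  · intro j hj
    by_cases hne : j = 0
    · simp only [hne, if_true]
      exact fun h => absurd h hzb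
    · simp only [hne, if_false, Nat.add_one_ne_zero]
      exact hb j hj
  · simp
  · simp [he]

lemma leads_mem {d : ℕ} {φ : ℝ → Euc d → Euc d} {a y : Euc d}
    (h : leadsAp d φ a y) : y ∈ simplexSet d := by
  obtain ⟨k, xs, ts, ⟨hk, hm, -⟩, h0, he⟩ := h 1 one_pos 1 one_pos
  exact he ▸ hm (k + 1) le_rfl

lemma closed_simplex (d : ℕ) : IsClosed (simplexSet d) := by
  have h1 : IsClosed {x : Euc d | ∀ i, 0 ≤ x i} := by
    simp only [setOf_forall]
    exact isClosed_iInter fun i => isClosed_le continuous_const (by fun_prop)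
  have h2 : IsClosed {x : Euc d | ∑ i, x i = 1} :=
    isClosed_eq (by fun_prop) continuous_const
  exact h1.inter h2

lemma near_not_bd {d : ℕ} {z : Euc d} (hz : z ∈ simplexSet d) (hzb : z ∉ simplexBd d) :
    ∃ r > 0, ∀ y, dist z y < r → y ∉ simplexBd d := by
  have hzi : z ∈ simplexInt d := by
    by_contra h
    exact hzb ⟨hz, h⟩
  have ho : IsOpen {x : Euc d | ∀ i, 0 < x i} := by
    simp only [setOf_forall]
    exact isOpen_iInter_of_finite fun i => isOpen_lt continuous_const (by fun_prop)
  obtain ⟨r, hr, hb⟩ := Metric.isOpen_iff.1 ho z hzi.1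
  refine ⟨r, hr, fun y hy hyb => hyb.2 ⟨hb ?_, hyb.1.2⟩⟩
  rwa [Metric.mem_ball, dist_comm]

/-- for `x ∈ R_ap`, `cl([x]_ap) ⊆ [x]_ap ∪ ∂Δ`, and `[x]_ap` is
invariant under the flow: `φ_t([x]_ap) = [x]_ap` for every `t`. -/
theorem stmt5 {d : ℕ} (F : Euc d → Euc d) (hF : IsMeanField d F)
    (φ : ℝ → Euc d → Euc d) (hφ : IsFlowOf d F φ)
    (x : Euc d) (hx : x ∈ Rap d φ) :
    closure (apClass d φ x) ⊆ apClass d φ x ∪ simplexBd d ∧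
    ∀ t : ℝ, φ t '' apClass d φ x = apClass d φ x := by
  have key : ∀ t : ℝ, ∀ y ∈ apClass d φ x, φ t y ∈ apClass d φ x :=
    fun t y hy => ⟨leads_flow_end hφ t hy.1, leads_flow_start hφ t hy.2⟩
  refine ⟨fun z hz => ?_, fun t => ?_⟩
  · by_cases hzb : z ∈ simplexBd d
    · exact Or.inr hzb
    left
    have hzs : z ∈ simplexSet d :=
      closure_minimal (fun y hy => leads_mem hy.1) (closed_simplex d) hz
    obtain ⟨r, hr, hn⟩ := near_not_bd hzs hzb
    have hcl := Metric.mem_closure_iff.1 hz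
    constructor
    · refine leads_close_end hzs fun ε hε => ?_
      obtain ⟨y, hy, hd⟩ := hcl (min ε r) (lt_min hε hr)
      exact ⟨y, hn y (hd.trans_le (min_le_right _ _)), hd.trans_le (min_le_left _ _), hy.1⟩
    · refine leads_close_start hzs hzb fun ε hε => ?_
      obtain ⟨y, hy, hd⟩ := hcl ε hε
      exact ⟨y, hd, hy.2⟩
  · apply Subset.antisymm
    · rintro _ ⟨y, hy, rfl⟩
      exact key t y hy
    · intro y hy
      refine ⟨φ (-t) y, key (-t) y hy, ?_⟩
      rw [← hφ.map_add, add_neg_cancel, hφ.map_zero]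

end
end

section
/- For every δ > 0 there exists T_0 > 0 such that every (δ,T_0) ap-pseudo-orbit for the flow {φ_t} intersects the δ-neighborhood N^δ(R_ap) of the set of ap-chain-recurrent points. -/
open Metric Set Filter Topology
open scoped Classical ENNReal

noncomputable section

lemma aux_compact (d : ℕ) : IsCompact (simplexSet d) := by
  have h := (isCompact_stdSimplex ℝ (Fin d)).image (PiLp.continuous_toLp 2 (fun _ : Fin d => ℝ))
  convert h using 1
  ext x
  constructor
  · rintro ⟨h0, h1⟩
    exact ⟨x.ofLp, ⟨h0, h1⟩, rfl⟩
  · rintro ⟨y, ⟨h0, h1⟩, rfl⟩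
    exact ⟨h0, h1⟩

lemma aux_closed (d : ℕ) : IsClosed (simplexBd d) := by
  have : simplexBd d = simplexSet d ∩ ⋃ i : Fin d, {x : Euc d | x i ≤ 0} := by
    ext x
    simp only [simplexBd, simplexInt, simplexSet, mem_diff, mem_setOf_eq, mem_inter_iff,
      mem_iUnion, not_and]
    constructor
    · rintro ⟨h, h'⟩
      refine ⟨h, ?_⟩
      by_contra hc
      push Not at hc
      exact h' hc h.2
    · rintro ⟨h, i, hi⟩
      exact ⟨h, fun h' => absurd (h' i) (not_lt.mpr hi)⟩
  rw [this]
  refine (aux_compact d).isClosed.inter (isClosed_iUnion_of_finite fun i => ?_)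
  exact isClosed_le (by fun_prop) continuous_const

lemma aux_omega {d : ℕ} {F : Euc d → Euc d} {φ : ℝ → Euc d → Euc d} (hφ : IsFlowOf d F φ)
    {x : Euc d} (hx : x ∈ simplexSet d) :
    ∃ y ∈ simplexSet d, (x ∈ simplexBd d → y ∈ simplexBd d) ∧
      ∀ ε > 0, ∀ T : ℝ, ∃ t ≥ T, dist (φ t x) y < ε := by
  obtain ⟨y, hy, hc⟩ := (aux_compact d).exists_mapClusterPt (f := (atTop : Filter ℝ))
    (u := fun t => φ t x) (le_principal_iff.2 (Filter.mem_map.2 (Filter.Eventually.of_forall fun t => hφ.inv t x hx)))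
  have key : ∀ ε > 0, ∀ T : ℝ, ∃ t ≥ T, dist (φ t x) y < ε := by
    intro ε hε T
    have := (mapClusterPt_iff_frequently.mp hc) _ (Metric.ball_mem_nhds y hε)
    obtain ⟨t, ht, h⟩ := (frequently_atTop.mp this) T
    exact ⟨t, ht, h⟩
  refine ⟨y, hy, fun hb => ?_, key⟩
  rw [← (aux_closed d).closure_eq, Metric.mem_closure_iff]
  intro ε hε
  obtain ⟨t, -, ht⟩ := key ε hε 0
  exact ⟨φ t x, hφ.bdInv t x hb, by rwa [dist_comm]⟩

lemma aux_rec {d : ℕ} {F : Euc d → Euc d} {φ : ℝ → Euc d → Euc d} (hφ : IsFlowOf d F φ)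
    {x y : Euc d} (hx : x ∈ simplexSet d) (hy : y ∈ simplexSet d)
    (hb : x ∈ simplexBd d ↔ y ∈ simplexBd d)
    (h : ∀ ε > 0, ∀ T : ℝ, ∃ t ≥ T, dist (φ t x) y < ε) : y ∈ Rap d φ := by
  intro δ hδ T hT
  obtain ⟨s, -, h1⟩ := h δ hδ 0
  obtain ⟨r, hr, h2⟩ := h δ hδ (s + T)
  have hbs : φ s x ∈ simplexBd d ↔ y ∈ simplexBd d := by
    rw [← hb]
    refine ⟨fun h => ?_, hφ.bdInv s x⟩
    have := hφ.bdInv (-s) _ h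
    rwa [← hφ.map_add, neg_add_cancel, hφ.map_zero] at this
  refine ⟨1, fun j => if j = 1 then φ s x else y, fun _ => r - s, ⟨le_rfl, ?_, ?_, ?_, ?_⟩,
    by simp, by simp⟩
  · intro j _
    by_cases hj : j = 1
    · simpa [hj] using hφ.inv s x hx
    · simpa [hj] using hy
  · simpa [dist_comm] using h1
  · intro j hj1 hj2
    obtain rfl : j = 1 := le_antisymm hj2 hj1
    refine ⟨by linarith, ?_⟩
    simpa [← hφ.map_add] using h2
  · intro j hj
    interval_cases j
    · simpa using hbs.2
    · simpa using hbs.1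

lemma aux_hit {d : ℕ} {F : Euc d → Euc d} {φ : ℝ → Euc d → Euc d} (hφ : IsFlowOf d F φ)
    {x : Euc d} (hx : x ∈ simplexSet d) {δ : ℝ} (hδ : 0 < δ) :
    ∃ t ≥ 0, φ t x ∈ Metric.thickening δ (Rap d φ) := by
  obtain ⟨y, hy, hxy, h⟩ := aux_omega hφ hx
  by_cases hb : x ∈ simplexBd d ↔ y ∈ simplexBd d
  · obtain ⟨t, ht, h'⟩ := h δ hδ 0
    exact ⟨t, ht, Metric.mem_thickening_iff.2 ⟨y, aux_rec hφ hx hy hb h, h'⟩⟩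
  · have hyb : y ∈ simplexBd d := by tauto
    obtain ⟨z, hz, hyz, h'⟩ := aux_omega hφ hy
    have hzR := aux_rec hφ hy hz ⟨hyz, fun _ => hyb⟩ h'
    obtain ⟨s, hs, hsz⟩ := h' δ hδ 0
    have hc : Continuous (φ s) := hφ.cont.comp (by fun_prop : Continuous fun w => (s, w))
    have ho : IsOpen (φ s ⁻¹' Metric.ball z δ) := Metric.isOpen_ball.preimage hc
    obtain ⟨ε, hε, hsub⟩ := Metric.isOpen_iff.1 ho y hsz
    obtain ⟨r, hr, hry⟩ := h ε hε 0
    refine ⟨s + r, by linarith, Metric.mem_thickening_iff.2 ⟨z, hzR, ?_⟩⟩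
    rw [hφ.map_add]
    exact hsub hry

/-- for every `δ > 0` there is `T₀ > 0` such that every `(δ,T₀)`
ap-pseudo-orbit intersects the `δ`-neighborhood of `R_ap`. -/
theorem stmt10 {d : ℕ} (F : Euc d → Euc d) (hF : IsMeanField d F)
    (φ : ℝ → Euc d → Euc d) (hφ : IsFlowOf d F φ) :
    ∀ δ > (0 : ℝ), ∃ T₀ > (0 : ℝ),
      ∀ (k : ℕ) (xs : ℕ → Euc d) (ts : ℕ → ℝ), IsAPOrbit d φ δ T₀ k xs ts →
        ∃ z ∈ Metric.thickening δ (Rap d φ),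
          z = xs 0 ∨ z = xs (k + 1) ∨
          ∃ j, 1 ≤ j ∧ j ≤ k ∧ ∃ t ∈ Icc (0 : ℝ) (ts j), z = φ t (xs j) := by
  intro δ hδ
  have hcov := (aux_compact d).elim_directed_cover
    (fun n : ℕ => ⋃ t ∈ Icc (0 : ℝ) n, φ t ⁻¹' Metric.thickening δ (Rap d φ))
    (fun n => isOpen_biUnion fun t _ => Metric.isOpen_thickening.preimage
      (hφ.cont.comp (by fun_prop : Continuous fun w => (t, w))))
    (fun x hx => by
      obtain ⟨t, ht, h⟩ := aux_hit hφ hx hδ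
      obtain ⟨n, hn⟩ := exists_nat_ge t
      exact mem_iUnion.2 ⟨n, mem_iUnion₂.2 ⟨t, ⟨ht, hn⟩, h⟩⟩)
    (Monotone.directed_le fun m n hmn => biUnion_subset_biUnion_left
      (Icc_subset_Icc_right (by exact_mod_cast hmn)))
  obtain ⟨n, hn⟩ := hcov
  refine ⟨n + 1, by positivity, fun k xs ts ⟨hk, hmem, _, hts, _⟩ => ?_⟩
  obtain ⟨t, ht, h⟩ := mem_iUnion₂.1 (hn (hmem 1 (by omega)))
  have := (hts 1 le_rfl hk).1
  exact ⟨φ t (xs 1), h, Or.inr (Or.inr ⟨1, le_rfl, hk, t, ⟨ht.1, by linarith [ht.2]⟩, rfl⟩)⟩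

end
end

section
/- Let E* be a finite set and let Q* be an E*×E* matrix with nonnegative real entries which is substochastic (all row sums ≤ 1), has at least one row sum strictly less than 1, and is irreducible and aperiodic. Then there exist a unique ρ = e^{−θ} ∈ (0,1), a unique row vector μ with μ Q* = ρ μ, μ_i > 0 for all i and Σ_i μ_i = 1, and a unique column vector π with Q* π = ρ π, π_i > 0 for all i and Σ_i μ_i π_i = 1; moreover: (Yaglom limit) for all i, j ∈ E*, lim_{n→∞} (Q*^n)_{ij} / Σ_{k∈E*} (Q*^n)_{ik} = μ_j; and for all i, j ∈ E*, lim_{n→∞} e^{θ n} (Q*^n)_{ij} = π_i μ_j. -/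
open Filter Topology

noncomputable section


lemma posMulVec {E : Type*} [Fintype E] (P : Matrix E E ℝ) (hP : ∀ i j, 0 < P i j)
    (z : E → ℝ) (hz : ∀ i, 0 ≤ z i) (hz0 : z ≠ 0) (i : E) : 0 < P.mulVec z i := by
  obtain ⟨j, hj⟩ := Function.ne_iff.mp hz0
  have hj' : 0 < z j := lt_of_le_of_ne (hz j) (Ne.symm hj)
  exact Finset.sum_pos' (fun k _ => mul_nonneg (hP i k).le (hz k))
    ⟨j, Finset.mem_univ _, mul_pos (hP i j) hj'⟩

lemma powEig {E : Type*} [Fintype E] [DecidableEq E] (A : Matrix E E ℝ) (r : ℝ) (x : E → ℝ)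
    (h : A.mulVec x = r • x) (n : ℕ) : (A ^ n).mulVec x = r ^ n • x := by
  induction n with
  | zero => simp
  | succ n ih =>
    rw [pow_succ, ← Matrix.mulVec_mulVec, h, Matrix.mulVec_smul, ih, smul_smul]
    congr 1
    ring

lemma perronExists {E : Type*} [Fintype E] [DecidableEq E] [Nonempty E]
    (A : Matrix E E ℝ) (hA : ∀ i j, 0 ≤ A i j) (N : ℕ) (hN : 1 ≤ N)
    (hP : ∀ i j, 0 < (A ^ N) i j) :
    ∃ (r : ℝ) (x : E → ℝ), 0 < r ∧ (∀ i, 0 < x i) ∧ A.mulVec x = r • x := by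
  set C : ℝ := ∑ i, ∑ j, A i j with hC
  have hC0 : 0 ≤ C := Finset.sum_nonneg fun i _ => Finset.sum_nonneg fun j _ => hA i j
  let K : Set (ℝ × (E → ℝ)) :=
    (Set.Icc 0 C ×ˢ stdSimplex ℝ E) ∩ {p | ∀ i, p.1 * p.2 i ≤ A.mulVec p.2 i}
  have hK : IsCompact K := by
    refine (isCompact_Icc.prod (isCompact_stdSimplex ℝ E)).inter_right ?_
    have : {p : ℝ × (E → ℝ) | ∀ i, p.1 * p.2 i ≤ A.mulVec p.2 i}
        = ⋂ i, {p : ℝ × (E → ℝ) | p.1 * p.2 i ≤ A.mulVec p.2 i} := by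
      ext p; simp
    rw [this]
    refine isClosed_iInter fun i => isClosed_le (by fun_prop) ?_
    simp only [Matrix.mulVec, dotProduct]
    fun_prop
  have hKne : K.Nonempty := by
    obtain ⟨i0⟩ := ‹Nonempty E›
    refine ⟨(0, Pi.single i0 1), ⟨⟨le_refl _, hC0⟩, single_mem_stdSimplex ℝ i0⟩, ?_⟩
    intro i
    simp [hA]
  obtain ⟨⟨r, x⟩, hmem, hmax⟩ := hK.exists_isMaxOn hKne continuous_fst.continuousOn
  obtain ⟨⟨hr, hx⟩, hrx⟩ := hmem
  simp only [Set.mem_Icc] at hr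
  have hxn : ∀ i, 0 ≤ x i := hx.1
  have hxs : ∑ i, x i = 1 := hx.2
  replace hrx : ∀ i, r * x i ≤ A.mulVec x i := hrx
  have hx0 : x ≠ 0 := by
    rintro rfl
    simp at hxs
  have hy := posMulVec _ hP x hxn hx0
  have heig : A.mulVec x = r • x := by
    by_contra hne
    have hz := posMulVec _ hP (A.mulVec x - r • x) (fun i => by simpa using hrx i)
      (sub_ne_zero.mpr hne)
    set y := (A ^ N).mulVec x with hydef
    have hcomm : (A ^ N).mulVec (A.mulVec x - r • x) = A.mulVec y - r • y := by
      rw [Matrix.mulVec_sub, Matrix.mulVec_smul, hydef, Matrix.mulVec_mulVec, Matrix.mulVec_mulVec,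
        ← pow_succ, ← pow_succ']
    rw [hcomm] at hz
    obtain ⟨i0, hi0⟩ := Finite.exists_min (fun i => A.mulVec y i / y i)
    set s := A.mulVec y i0 / y i0 with hs
    have hrs : r < s := by
      rw [hs, lt_div_iff₀ (hy i0)]
      have := hz i0
      simp at this
      linarith
    have hsy : ∀ i, s * y i ≤ A.mulVec y i := fun i => by
      have := hi0 i
      rwa [le_div_iff₀ (hy i)] at this
    set S := ∑ i, y i with hS
    have hSpos : 0 < S := Finset.sum_pos (fun i _ => hy i) Finset.univ_nonempty
    have hyS : ∀ j, y j ≤ S := fun j =>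
      Finset.single_le_sum (f := y) (fun i _ => (hy i).le) (Finset.mem_univ j)
    have hsC : s ≤ C := by
      have h1 : s * S ≤ C * S := by
        calc s * S = ∑ i, s * y i := by rw [hS, Finset.mul_sum]
          _ ≤ ∑ i, A.mulVec y i := Finset.sum_le_sum fun i _ => hsy i
          _ ≤ ∑ i, ∑ j, A i j * S := Finset.sum_le_sum fun i _ => Finset.sum_le_sum fun j _ =>
              mul_le_mul_of_nonneg_left (hyS j) (hA i j)
          _ = C * S := by simp only [hC, Finset.sum_mul]
      exact le_of_mul_le_mul_right h1 hSpos
    have hin : (s, S⁻¹ • y) ∈ K := by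
      refine ⟨⟨⟨hr.1.trans hrs.le, hsC⟩, ⟨fun i => ?_, ?_⟩⟩, fun i => ?_⟩
      · exact mul_nonneg (inv_nonneg.mpr hSpos.le) (hy i).le
      · simp only [Pi.smul_apply, smul_eq_mul, ← Finset.mul_sum]
        exact inv_mul_cancel₀ hSpos.ne'
      · simp only [Matrix.mulVec_smul, Pi.smul_apply, smul_eq_mul]
        have := mul_le_mul_of_nonneg_left (hsy i) (inv_nonneg.mpr hSpos.le)
        linarith
    have := hmax hin
    simp at this
    linarith
  have hpow := powEig A r x heig N
  have hrx' : ∀ i, 0 < r ^ N * x i := fun i => by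
    have := hy i
    rw [hpow] at this
    simpa using this
  have hr0 : 0 < r := by
    rcases hr.1.lt_or_eq with h | h
    · exact h
    · obtain ⟨i0⟩ := ‹Nonempty E›
      have := hrx' i0
      rw [← h, zero_pow (by omega)] at this
      simp at this
  exact ⟨r, x, hr0, fun i => (pos_iff_pos_of_mul_pos (hrx' i)).mp (pow_pos hr0 N), heig⟩

lemma powPosMul {E : Type*} [Fintype E] [DecidableEq E] (Q : Matrix E E ℝ)
    (hnn : ∀ i j, 0 ≤ Q i j) {a b : ℕ} {i j k : E} (h1 : 0 < (Q ^ a) i j)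
    (h2 : 0 < (Q ^ b) j k) : 0 < (Q ^ (a + b)) i k := by
  rw [pow_add, Matrix.mul_apply]
  exact Finset.sum_pos' (fun l _ => mul_nonneg (Matrix.pow_apply_nonneg hnn a i l)
    (Matrix.pow_apply_nonneg hnn b l k)) ⟨j, Finset.mem_univ _, mul_pos h1 h2⟩

lemma primExists {E : Type*} [Fintype E] [DecidableEq E]
    (Q : Matrix E E ℝ) (hnn : ∀ i j, 0 ≤ Q i j)
    (hirr : ∀ i j, ∃ n : ℕ, 0 < (Q ^ n) i j)
    (haper : ∀ i, ∀ m : ℕ, (∀ n : ℕ, 0 < (Q ^ n) i i → m ∣ n) → m = 1) :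
    ∃ N : ℕ, 1 ≤ N ∧ ∀ i j, 0 < (Q ^ N) i j := by
  have h1 : ∀ i, ∃ n0 : ℕ, ∀ n ≥ n0, 0 < (Q ^ n) i i := by
    intro i
    let S : AddSubmonoid ℕ :=
      { carrier := {n | 0 < (Q ^ n) i i}
        zero_mem' := by simp
        add_mem' := fun {a b} ha hb => powPosMul Q hnn ha hb }
    obtain ⟨n0, hn0⟩ := Nat.exists_mem_closure_of_ge (S : Set ℕ)
    refine ⟨n0, fun n hn => ?_⟩
    have hg : Nat.setGcd (S : Set ℕ) = 1 :=
      haper i _ fun n hn => Nat.setGcd_dvd_of_mem (s := (S : Set ℕ)) hn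
    have := hn0 n hn (by rw [hg]; exact one_dvd n)
    rw [AddSubmonoid.closure_eq] at this
    exact this
  choose n0 hn0 using h1
  choose m hm using hirr
  refine ⟨(∑ i, n0 i) + (∑ i, ∑ j, m i j) + 1, by omega, fun i j => ?_⟩
  have e1 : n0 i ≤ ∑ i, n0 i := Finset.single_le_sum (f := n0) (fun _ _ => Nat.zero_le _) (Finset.mem_univ i)
  have e2 : m i j ≤ ∑ i, ∑ j, m i j :=
    (Finset.single_le_sum (f := fun j => m i j) (fun _ _ => Nat.zero_le _) (Finset.mem_univ j)).trans
    (Finset.single_le_sum (f := fun i => ∑ j, m i j) (fun _ _ => Nat.zero_le _) (Finset.mem_univ i))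
  set T := (∑ i, n0 i) + (∑ i, ∑ j, m i j) + 1
  have : T = (T - m i j) + m i j := by omega
  rw [this]
  exact powPosMul Q hnn (hn0 i _ (by omega)) (hm i j)

/-- Domination is preserved by a nonnegative matrix. -/
lemma domMulVec {E : Type*} [Fintype E] (R : Matrix E E ℝ) (hR : ∀ i j, 0 ≤ R i j)
    (x f : E → ℝ) (q c : ℝ) (hx : R.mulVec x = q • x) (hf : ∀ i, |f i| ≤ c * x i) (i : E) :
    |R.mulVec f i| ≤ c * q * x i := by
  have hxi : ∑ j, R i j * x j = q * x i := by
    have := congrFun hx i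
    simpa [Matrix.mulVec, dotProduct] using this
  calc |R.mulVec f i| ≤ ∑ j, |R i j * f j| := Finset.abs_sum_le_sum_abs _ _
    _ ≤ ∑ j, c * (R i j * x j) := Finset.sum_le_sum fun j _ => by
        rw [abs_mul, abs_of_nonneg (hR i j)]
        have := mul_le_mul_of_nonneg_left (hf j) (hR i j)
        linarith
    _ = c * q * x i := by rw [← Finset.mul_sum, hxi]; ring

lemma decay {E : Type*} [Fintype E] [DecidableEq E] [Nonempty E]
    (M : Matrix E E ℝ) (hM : ∀ i j, 0 ≤ M i j) (N : ℕ)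
    (hP : ∀ i j, 0 < (M ^ N) i j) (μ x : E → ℝ) (hμ : ∀ i, 0 < μ i) (hx : ∀ i, 0 < x i)
    (hμx : μ ⬝ᵥ x = 1) (hMμ : Matrix.vecMul μ M = μ) (hMx : M.mulVec x = x)
    (g : E → ℝ) (hg : μ ⬝ᵥ g = 0) (i : E) :
    Tendsto (fun n : ℕ => (M ^ n).mulVec g i) atTop (𝓝 0) := by
  have hgn : ∀ n, μ ⬝ᵥ (M ^ n).mulVec g = 0 := by
    intro n
    induction n with
    | zero => simpa using hg
    | succ n ih => rw [pow_succ', ← Matrix.mulVec_mulVec, Matrix.dotProduct_mulVec, hMμ, ih]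
  have hMNx : (M ^ N).mulVec x = x := by
    have := powEig M 1 x (by simpa using hMx) N
    simpa using this
  obtain ⟨⟨a, b⟩, hab⟩ := Finite.exists_min (fun p : E × E => (M ^ N) p.1 p.2 / (x p.1 * μ p.2))
  set d := (M ^ N) a b / (x a * μ b) with hd
  have hd0 : 0 < d := div_pos (hP a b) (mul_pos (hx a) (hμ b))
  let R : Matrix E E ℝ := M ^ N - d • Matrix.vecMulVec x μ
  have hR : ∀ i j, 0 ≤ R i j := by
    intro i j
    have := hab (i, j)
    simp only at this
    rw [le_div_iff₀ (mul_pos (hx i) (hμ j))] at this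
    simp only [R, Matrix.sub_apply, Matrix.smul_apply, Matrix.vecMulVec_apply, smul_eq_mul]
    linarith
  have hRx : R.mulVec x = (1 - d) • x := by
    simp only [R, Matrix.sub_mulVec, Matrix.smul_mulVec, Matrix.vecMulVec_mulVec, hMNx, hμx]
    ext k
    simp
    ring
  have hRf : ∀ f, μ ⬝ᵥ f = 0 → R.mulVec f = (M ^ N).mulVec f := by
    intro f hf
    simp only [R, Matrix.sub_mulVec, Matrix.smul_mulVec, Matrix.vecMulVec_mulVec, hf]
    simp
  have hd1 : 0 ≤ 1 - d := by
    have h := congrFun hRx a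
    have h2 : 0 ≤ R.mulVec x a := Finset.sum_nonneg fun j _ => mul_nonneg (hR a j) (hx j).le
    rw [h] at h2
    exact nonneg_of_mul_nonneg_left (by simpa using h2) (hx a)
  obtain ⟨c, hc⟩ : ∃ c, ∀ i, |g i| ≤ c * x i := by
    obtain ⟨k, hk⟩ := Finite.exists_max (fun i => |g i| / x i)
    exact ⟨|g k| / x k, fun i => (div_le_iff₀ (hx i)).mp (hk i)⟩
  have key : ∀ k i, |(M ^ (N * k)).mulVec g i| ≤ (c * (1 - d) ^ k) * x i := by
    intro k
    induction k with
    | zero => simpa using hc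
    | succ k ih =>
      intro i
      have h := domMulVec R hR x _ (1 - d) _ hRx ih i
      rw [hRf _ (hgn _), Matrix.mulVec_mulVec, ← pow_add] at h
      have e : N * (k + 1) = N + N * k := by ring
      rw [e]
      refine h.trans (le_of_eq ?_)
      ring
  have key2 : ∀ k m i, |(M ^ (N * k + m)).mulVec g i| ≤ (c * (1 - d) ^ k) * x i := by
    intro k m
    induction m with
    | zero => simpa using key k
    | succ m ih =>
      intro i
      have h := domMulVec M hM x _ 1 _ (by simpa using hMx) ih i
      rw [Matrix.mulVec_mulVec, ← pow_succ'] at h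
      simpa [add_assoc] using h
  have hlim : Tendsto (fun k : ℕ => (c * (1 - d) ^ k) * x i) atTop (𝓝 0) := by
    have := tendsto_pow_atTop_nhds_zero_of_lt_one hd1 (by linarith : 1 - d < 1)
    simpa using (this.const_mul c).mul_const (x i)
  rw [Metric.tendsto_atTop]
  intro ε hε
  obtain ⟨k, hk⟩ := (hlim.eventually (gt_mem_nhds hε)).exists
  refine ⟨N * k, fun n hn => ?_⟩
  obtain ⟨m, rfl⟩ := Nat.exists_eq_add_of_le hn
  rw [Real.dist_eq, sub_zero]
  exact (key2 k m i).trans_lt hk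

lemma limM {E : Type*} [Fintype E] [DecidableEq E] [Nonempty E]
    (M : Matrix E E ℝ) (hM : ∀ i j, 0 ≤ M i j) (N : ℕ)
    (hP : ∀ i j, 0 < (M ^ N) i j) (μ x : E → ℝ) (hμ : ∀ i, 0 < μ i) (hx : ∀ i, 0 < x i)
    (hμx : μ ⬝ᵥ x = 1) (hMμ : Matrix.vecMul μ M = μ) (hMx : M.mulVec x = x) (i j : E) :
    Tendsto (fun n : ℕ => (M ^ n) i j) atTop (𝓝 (x i * μ j)) := by
  have h := decay M hM N hP μ x hμ hx hμx hMμ hMx (Pi.single j 1 - μ j • x)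
    (by rw [dotProduct_sub, dotProduct_smul, hμx]; simp) i
  have h2 := h.add_const (x i * μ j)
  rw [zero_add] at h2
  refine h2.congr fun n => ?_
  have := powEig M 1 x (by simpa using hMx) n
  rw [Matrix.mulVec_sub, Matrix.mulVec_smul, this]
  simp
  ring

/-- Perron–Frobenius for substochastic matrices: existence and
uniqueness of the quasi-stationary distribution `μ` (normalized positive left
eigenvector), the normalized positive right eigenvector `π`, the eigenvalue
`ρ = e^{-θ} ∈ (0,1)`, the Yaglom limit, and the asymptotics of `Q^n`. -/
theorem stmt18 {E : Type*} [Fintype E] [DecidableEq E] [Nonempty E]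
    (Q : Matrix E E ℝ)
    (hnn : ∀ i j, 0 ≤ Q i j)
    (hsub : ∀ i, ∑ j, Q i j ≤ 1)
    (hstrict : ∃ i, ∑ j, Q i j < 1)
    (hirr : ∀ i j, ∃ n : ℕ, 0 < (Q ^ n) i j)
    (haper : ∀ i, ∀ m : ℕ, (∀ n : ℕ, 0 < (Q ^ n) i i → m ∣ n) → m = 1) :
    ∃ (ρ θ : ℝ) (μ π : E → ℝ),
      ρ = Real.exp (-θ) ∧ 0 < ρ ∧ ρ < 1 ∧
      (∀ i, 0 < μ i) ∧ (∑ i, μ i = 1) ∧ (∀ j, ∑ i, μ i * Q i j = ρ * μ j) ∧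
      (∀ i, 0 < π i) ∧ (∑ i, μ i * π i = 1) ∧ (∀ i, ∑ j, Q i j * π j = ρ * π i) ∧
      (∀ (ρ' : ℝ) (μ' : E → ℝ), (∀ i, 0 < μ' i) → (∑ i, μ' i = 1) →
        (∀ j, ∑ i, μ' i * Q i j = ρ' * μ' j) → ρ' = ρ ∧ μ' = μ) ∧
      (∀ (ρ' : ℝ) (π' : E → ℝ), (∀ i, 0 < π' i) → (∑ i, μ i * π' i = 1) →
        (∀ i, ∑ j, Q i j * π' j = ρ' * π' i) → ρ' = ρ ∧ π' = π) ∧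
      (∀ i j, Tendsto (fun n : ℕ => (Q ^ n) i j / ∑ k, (Q ^ n) i k)
        atTop (nhds (μ j))) ∧
      (∀ i j, Tendsto (fun n : ℕ => Real.exp (θ * n) * (Q ^ n) i j)
        atTop (nhds (π i * μ j))) := by
  classical
  obtain ⟨N, hN, hP⟩ := primExists Q hnn hirr haper
  obtain ⟨ρ, p, hρ, hp, hQp⟩ := perronExists Q hnn N hN hP
  obtain ⟨ρ₂, m, -, hm, hQm⟩ := perronExists Q.transpose (fun i j => hnn j i) N hN
    (fun i j => by rw [← Matrix.transpose_pow]; exact hP j i)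
  rw [Matrix.mulVec_transpose] at hQm
  -- any positive left/right eigenpairs share the eigenvalue
  have share : ∀ (a b : ℝ) (u v : E → ℝ), (∀ i, 0 < u i) → (∀ i, 0 < v i) →
      Matrix.vecMul u Q = a • u → Q.mulVec v = b • v → a = b := by
    intro a b u v hu hv h1 h2
    have h3 := Matrix.dotProduct_mulVec u Q v
    rw [h1, h2, dotProduct_smul, smul_dotProduct] at h3
    have hpos : 0 < u ⬝ᵥ v := Finset.sum_pos (fun i _ => mul_pos (hu i) (hv i)) Finset.univ_nonempty
    exact (mul_right_cancel₀ hpos.ne' h3).symm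
  obtain rfl : ρ₂ = ρ := share _ _ m p hm hp hQm hQp
  set S := ∑ i, m i with hS
  have hS0 : 0 < S := Finset.sum_pos (fun i _ => hm i) Finset.univ_nonempty
  obtain ⟨μ, hμdef⟩ : ∃ μ : E → ℝ, μ = S⁻¹ • m := ⟨_, rfl⟩
  have hμ : ∀ i, 0 < μ i := fun i => by
    rw [hμdef]; exact mul_pos (inv_pos.mpr hS0) (hm i)
  have hμ1 : ∑ i, μ i = 1 := by
    rw [hμdef]
    simp only [Pi.smul_apply, smul_eq_mul, ← Finset.mul_sum]
    exact inv_mul_cancel₀ hS0.ne'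
  have hQμ : Matrix.vecMul μ Q = ρ₂ • μ := by
    rw [hμdef, Matrix.smul_vecMul, hQm, smul_comm]
  have hT0 : 0 < μ ⬝ᵥ p := Finset.sum_pos (fun i _ => mul_pos (hμ i) (hp i)) Finset.univ_nonempty
  obtain ⟨π, hπdef⟩ : ∃ π : E → ℝ, π = (μ ⬝ᵥ p)⁻¹ • p := ⟨_, rfl⟩
  have hπ : ∀ i, 0 < π i := fun i => by
    rw [hπdef]; exact mul_pos (inv_pos.mpr hT0) (hp i)
  have hμπ : μ ⬝ᵥ π = 1 := by
    rw [hπdef, dotProduct_smul]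
    exact inv_mul_cancel₀ hT0.ne'
  have hQπ : Q.mulVec π = ρ₂ • π := by
    rw [hπdef, Matrix.mulVec_smul, hQp, smul_comm]
  clear hμdef hπdef
  have hρ1 : ρ₂ < 1 := by
    have h1 : ∑ j, Matrix.vecMul μ Q j = ρ₂ := by
      rw [hQμ]
      simp [← Finset.mul_sum, hμ1]
    have h2 : ∑ j, Matrix.vecMul μ Q j = ∑ i, μ i * ∑ j, Q i j := by
      simp only [Matrix.vecMul, dotProduct, Finset.mul_sum]
      exact Finset.sum_comm
    rw [← h1, h2, ← hμ1]
    obtain ⟨i0, hi0⟩ := hstrict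
    refine Finset.sum_lt_sum (fun i _ => ?_) ⟨i0, Finset.mem_univ _, ?_⟩
    · exact mul_le_of_le_one_right (hμ i).le (hsub i)
    · exact mul_lt_of_lt_one_right (hμ i0) hi0
  have hlim : ∀ i j, Tendsto (fun n : ℕ => (ρ₂⁻¹) ^ n * (Q ^ n) i j) atTop (𝓝 (π i * μ j)) := by
    intro i j
    have h := limM (ρ₂⁻¹ • Q) (fun i j => mul_nonneg (inv_nonneg.mpr hρ.le) (hnn i j)) N
      (fun i j => by
        rw [smul_pow]; exact mul_pos (pow_pos (inv_pos.mpr hρ) N) (hP i j)) μ π hμ hπ hμπ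
      (by rw [Matrix.vecMul_smul, hQμ, smul_smul, inv_mul_cancel₀ hρ.ne', one_smul])
      (by rw [Matrix.smul_mulVec, hQπ, smul_smul, inv_mul_cancel₀ hρ.ne', one_smul]) i j
    simpa [smul_pow] using h
  refine ⟨ρ₂, -Real.log ρ₂, μ, π, ?_, hρ, hρ1, hμ, hμ1, ?_, hπ, hμπ, ?_, ?_, ?_, ?_, ?_⟩
  · rw [neg_neg, Real.exp_log hρ]
  · intro j
    exact congrFun hQμ j
  · intro i
    exact congrFun hQπ i
  · intro ρ' μ' hμ' hμ'1 hQ'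
    have hQ'' : Matrix.vecMul μ' Q = ρ' • μ' := funext hQ'
    have hρ' : ρ' = ρ₂ := share _ _ μ' π hμ' hπ hQ'' hQπ
    subst hρ'
    refine ⟨rfl, ?_⟩
    have hpow : ∀ n j, ∑ i, μ' i * (Q ^ n) i j = ρ' ^ n * μ' j := by
      intro n j
      have := congrFun (powEig Q.transpose ρ' μ' (by rw [Matrix.mulVec_transpose, hQ'']) n) j
      rw [← Matrix.transpose_pow, Matrix.mulVec_transpose] at this
      exact this
    have hj : ∀ j, μ' j = (μ' ⬝ᵥ π) * μ j := by
      intro j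
      have h1 : Tendsto (fun n : ℕ => ∑ i, μ' i * ((ρ'⁻¹) ^ n * (Q ^ n) i j)) atTop
          (𝓝 (∑ i, μ' i * (π i * μ j))) :=
        tendsto_finsetSum _ fun i _ => (hlim i j).const_mul _
      have h2 : (fun n : ℕ => ∑ i, μ' i * ((ρ'⁻¹) ^ n * (Q ^ n) i j)) = fun _ => μ' j := by
        ext n
        have : ∑ i, μ' i * ((ρ'⁻¹) ^ n * (Q ^ n) i j) = (ρ'⁻¹) ^ n * ∑ i, μ' i * (Q ^ n) i j := by
          rw [Finset.mul_sum]
          exact Finset.sum_congr rfl fun i _ => by ring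
        rw [this, hpow, ← mul_assoc, ← mul_pow, inv_mul_cancel₀ hρ.ne', one_pow, one_mul]
      rw [h2] at h1
      rw [tendsto_nhds_unique tendsto_const_nhds h1, dotProduct, Finset.sum_mul]
      exact Finset.sum_congr rfl fun i _ => by ring
    have hc : μ' ⬝ᵥ π = 1 := by
      have : ∑ j, μ' j = ∑ j, (μ' ⬝ᵥ π) * μ j := Finset.sum_congr rfl fun j _ => hj j
      rw [hμ'1, ← Finset.mul_sum, hμ1, mul_one] at this
      exact this.symm
    ext j
    rw [hj j, hc, one_mul]
  · intro ρ' π' hπ' hπ'1 hQ'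
    have hQ'' : Q.mulVec π' = ρ' • π' := funext hQ'
    have hρ' : ρ₂ = ρ' := share _ _ μ π' hμ hπ' hQμ hQ''
    subst hρ'
    refine ⟨rfl, ?_⟩
    ext i
    have h1 : Tendsto (fun n : ℕ => ∑ j, ((ρ₂⁻¹) ^ n * (Q ^ n) i j) * π' j) atTop
        (𝓝 (∑ j, (π i * μ j) * π' j)) :=
      tendsto_finsetSum _ fun j _ => (hlim i j).mul_const _
    have h2 : (fun n : ℕ => ∑ j, ((ρ₂⁻¹) ^ n * (Q ^ n) i j) * π' j) = fun _ => π' i := by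
      ext n
      have : ∑ j, ((ρ₂⁻¹) ^ n * (Q ^ n) i j) * π' j = (ρ₂⁻¹) ^ n * ∑ j, (Q ^ n) i j * π' j := by
        rw [Finset.mul_sum]
        exact Finset.sum_congr rfl fun i _ => by ring
      have h3 : ∑ j, (Q ^ n) i j * π' j = ρ₂ ^ n * π' i := congrFun (powEig Q ρ₂ π' hQ'' n) i
      rw [this, h3, ← mul_assoc, ← mul_pow, inv_mul_cancel₀ hρ.ne', one_pow, one_mul]
    rw [h2] at h1
    have h4 : ∑ j, (π i * μ j) * π' j = π i := by
      simp only [mul_assoc]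
      rw [← Finset.mul_sum, hπ'1, mul_one]
    rw [tendsto_nhds_unique tendsto_const_nhds h1, h4]
  · intro i j
    have hden : Tendsto (fun n : ℕ => ∑ k, (ρ₂⁻¹) ^ n * (Q ^ n) i k) atTop
        (𝓝 (∑ k, π i * μ k)) := tendsto_finsetSum _ fun k _ => hlim i k
    rw [← Finset.mul_sum, hμ1, mul_one] at hden
    have h := (hlim i j).div hden (hπ i).ne'
    rw [mul_div_cancel_left₀ _ (hπ i).ne'] at h
    refine h.congr fun n => ?_
    simp only [Pi.div_apply]
    rw [← Finset.mul_sum, mul_div_mul_left _ _ (pow_pos (inv_pos.mpr hρ) n).ne']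
  · intro i j
    refine (hlim i j).congr fun n => ?_
    congr 1
    rw [mul_comm, Real.exp_nat_mul, Real.exp_neg, Real.exp_log hρ]

end
end
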